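/- Let f₁, f₂ : [0,∞) → ℝ be càdlàg and let z₁, z₂ be the (unique) càdlàg solutions of zᵢ(t) = fᵢ(t) − ∫₀ᵗ zᵢ(u) du for all t ≥ 0 (i = 1, 2). Then for every T ≥ 0, sup_{0 ≤ t ≤ T} |z₁(t) − z₂(t)| ≤ (2 − e^{−T}) · sup_{0 ≤ t ≤ T} |f₁(t) − f₂(t)|; in particular the solution map f ↦ z is continuous with respect to uniform convergence on compact intervals. -/

import Mathlib

open MeasureTheory Set Filter

/-- A real function is càdlàg on `[0, ∞)` if it is right-continuous at every `t ≥ 0`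
and has a finite left limit (within `[0, t)`) at every `t > 0`. -/
def IsCadlag (f : ℝ → ℝ) : Prop :=
  (∀ t : ℝ, 0 ≤ t → ContinuousWithinAt f (Set.Ici t) t) ∧
  (∀ t : ℝ, 0 < t → ∃ l : ℝ, Filter.Tendsto f (nhdsWithin t (Set.Ico 0 t)) (nhds l))

lemma IsCadlag.bdd {f : ℝ → ℝ} (hf : IsCadlag f) (T : ℝ) :
    ∃ C : ℝ, ∀ x ∈ Icc (0:ℝ) T, |f x| ≤ C := by
  refine IsCompact.induction_on (p := fun s => ∃ C : ℝ, ∀ x ∈ s, |f x| ≤ C)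
    (isCompact_Icc (a := (0:ℝ)) (b := T)) ⟨0, by simp⟩ ?_ ?_ ?_
  · rintro s t hst ⟨C, hC⟩
    exact ⟨C, fun x hx => hC x (hst hx)⟩
  · rintro s t ⟨C, hC⟩ ⟨D, hD⟩
    refine ⟨max C D, ?_⟩
    rintro x (hx | hx)
    · exact (hC x hx).trans (le_max_left _ _)
    · exact (hD x hx).trans (le_max_right _ _)
  · intro x hx
    have h1 : ∀ᶠ y in nhdsWithin x (Ici x), |f y| ≤ |f x| + 1 := by
      have h := (hf.1 x hx.1).tendsto.abs
      exact h.eventually (eventually_le_nhds (by linarith))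
    have h2 : ∃ C, ∀ᶠ y in nhdsWithin x (Ico 0 x), |f y| ≤ C := by
      rcases hx.1.eq_or_lt with h0 | h0
      · subst h0
        exact ⟨0, by simp⟩
      · obtain ⟨l, hl⟩ := hf.2 x h0
        exact ⟨|l| + 1, hl.abs.eventually (eventually_le_nhds (by linarith))⟩
    obtain ⟨C, h2⟩ := h2
    refine ⟨{y | |f y| ≤ max (|f x| + 1) C}, ?_, max (|f x| + 1) C, fun y hy => hy⟩
    have hsub : Icc (0:ℝ) T ⊆ Ici x ∪ Ico 0 x := by
      intro y hy
      rcases le_or_gt x y with h | h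
      · exact Or.inl h
      · exact Or.inr ⟨hy.1, h⟩
    refine nhdsWithin_mono x hsub ?_
    rw [nhdsWithin_union]
    refine mem_sup.2 ⟨?_, ?_⟩
    · filter_upwards [h1] with y hy using hy.trans (le_max_left _ _)
    · filter_upwards [h2] with y hy using hy.trans (le_max_right _ _)

lemma IsCadlag.aesm {f : ℝ → ℝ} (hf : IsCadlag f) :
    AEStronglyMeasurable f (volume.restrict (Ici (0:ℝ))) := by
  refine aestronglyMeasurable_of_tendsto_ae atTop
    (f := fun (n : ℕ) (t : ℝ) => f (((⌊((n:ℝ)+1) * t⌋₊ : ℝ) + 1) / ((n:ℝ)+1))) ?_ ?_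
  · intro n
    have h1 : Measurable (fun k : ℕ => f (((k : ℝ) + 1) / ((n:ℝ)+1))) := measurable_from_nat
    have h2 : Measurable (fun t : ℝ => ⌊((n:ℝ)+1) * t⌋₊) :=
      Nat.measurable_floor.comp (measurable_const.mul measurable_id)
    exact (h1.comp h2).aestronglyMeasurable
  · refine (ae_restrict_mem measurableSet_Ici).mono ?_
    intro t ht
    have ht : 0 ≤ t := ht
    refine (hf.1 t ht).tendsto.comp ?_
    refine tendsto_nhdsWithin_iff.2 ⟨?_, ?_⟩
    · have hl : Tendsto (fun n : ℕ => t + 1 / ((n:ℝ)+1)) atTop (nhds t) := by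
        simpa using (tendsto_one_div_add_atTop_nhds_zero_nat (𝕜 := ℝ)).const_add t
      refine tendsto_of_tendsto_of_tendsto_of_le_of_le tendsto_const_nhds hl ?_ ?_
      · intro n
        have hn : (0:ℝ) < (n:ℝ) + 1 := by positivity
        show t ≤ _ / _
        rw [le_div_iff₀ hn]
        linarith [Nat.lt_floor_add_one (((n:ℝ)+1) * t)]
      · intro n
        have hn : (0:ℝ) < (n:ℝ) + 1 := by positivity
        have := Nat.floor_le (a := ((n:ℝ)+1) * t) (by positivity)
        show _ / _ ≤ t + 1 / ((n:ℝ)+1)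
        rw [div_le_iff₀ hn, add_mul t, one_div, inv_mul_cancel₀ hn.ne']
        linarith
    · refine Eventually.of_forall fun n => ?_
      have hn : (0:ℝ) < (n:ℝ) + 1 := by positivity
      show t ≤ _ / _
      rw [le_div_iff₀ hn]
      linarith [Nat.lt_floor_add_one (((n:ℝ)+1) * t)]

lemma IsCadlag.intble {f : ℝ → ℝ} (hf : IsCadlag f) {T : ℝ} (hT : 0 ≤ T) :
    IntervalIntegrable f volume 0 T := by
  rw [intervalIntegrable_iff_integrableOn_Icc_of_le hT]
  obtain ⟨C, hC⟩ := hf.bdd T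
  refine Integrable.of_bound
    (hf.aesm.mono_measure (Measure.restrict_mono Icc_subset_Ici_self le_rfl)) C ?_
  exact (ae_restrict_mem measurableSet_Icc).mono fun x hx => hC x hx

/-- Lipschitz-type estimate for the map `f ↦ z`, where `z` solves
`z t = f t - ∫₀ᵗ z(u) du`: for every `T ≥ 0`,
`sup_{0 ≤ t ≤ T} |z₁ t - z₂ t| ≤ (2 - e^{-T}) · sup_{0 ≤ t ≤ T} |f₁ t - f₂ t|`. -/
theorem cadlag_solution_linear_continuous_dependence
    (f₁ f₂ z₁ z₂ : ℝ → ℝ) (hf₁ : IsCadlag f₁) (hf₂ : IsCadlag f₂)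
    (hz₁ : IsCadlag z₁) (hz₂ : IsCadlag z₂)
    (heq₁ : ∀ t : ℝ, 0 ≤ t → z₁ t = f₁ t - ∫ u in (0:ℝ)..t, z₁ u)
    (heq₂ : ∀ t : ℝ, 0 ≤ t → z₂ t = f₂ t - ∫ u in (0:ℝ)..t, z₂ u) :
    ∀ T : ℝ, 0 ≤ T → ∀ t ∈ Set.Icc (0:ℝ) T,
      |z₁ t - z₂ t| ≤ (2 - Real.exp (-T)) * ⨆ u : Set.Icc (0:ℝ) T, |f₁ u - f₂ u| := by
  
  intro T hT t ht
  set M := ⨆ u : Set.Icc (0:ℝ) T, |f₁ u - f₂ u| with hM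
  have hbdd : BddAbove (Set.range fun u : Set.Icc (0:ℝ) T => |f₁ u - f₂ u|) := by
    obtain ⟨C, hC⟩ := hf₁.bdd T
    obtain ⟨D, hD⟩ := hf₂.bdd T
    refine ⟨C + D, ?_⟩
    rintro _ ⟨u, rfl⟩
    exact (abs_sub _ _).trans (add_le_add (hC u u.2) (hD u u.2))
  have hg : ∀ u ∈ Icc (0:ℝ) T, |f₁ u - f₂ u| ≤ M := fun u hu => le_ciSup hbdd ⟨u, hu⟩
  have hM0 : 0 ≤ M := (abs_nonneg _).trans (hg 0 ⟨le_rfl, hT⟩)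
  have hint : IntervalIntegrable (fun u => z₁ u - z₂ u) volume 0 T :=
    (hz₁.intble hT).sub (hz₂.intble hT)
  have hd : ∀ s, 0 ≤ s → z₁ s - z₂ s = (f₁ s - f₂ s) - ∫ u in (0:ℝ)..s, (z₁ u - z₂ u) := by
    intro s hs
    rw [intervalIntegral.integral_sub (hz₁.intble hs) (hz₂.intble hs)]
    linarith [heq₁ s hs, heq₂ s hs]
  have key := image_norm_le_of_norm_deriv_right_le_deriv_boundary (a := 0) (b := T)
    (f := fun s => Real.exp s * ∫ u in (0:ℝ)..s, (z₁ u - z₂ u))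
    (f' := fun s => Real.exp s * (f₁ s - f₂ s))
    (B := fun s => M * (Real.exp s - 1)) (B' := fun s => M * Real.exp s)
    (by
      refine Real.continuous_exp.continuousOn.mul ?_
      have := intervalIntegral.continuousOn_primitive_interval' hint left_mem_uIcc
      rwa [uIcc_of_le hT] at this)
    (by
      intro x hx
      have h1 : HasDerivWithinAt (fun s => ∫ u in (0:ℝ)..s, (z₁ u - z₂ u)) (z₁ x - z₂ x)
          (Ici x) x := by
        refine intervalIntegral.integral_hasDerivWithinAt_right (t := Ioi x)
          ((hz₁.intble hx.1).sub (hz₂.intble hx.1)) ?_ ?_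
        · refine ⟨Ici 0, ?_, hz₁.aesm.sub hz₂.aesm⟩
          refine mem_of_superset self_mem_nhdsWithin ?_
          exact fun y hy => hx.1.trans (le_of_lt hy)
        · exact ((hz₁.1 x hx.1).sub (hz₂.1 x hx.1)).mono Ioi_subset_Ici_self
      have h2 := (Real.hasDerivAt_exp x).hasDerivWithinAt (s := Ici x) |>.mul h1
      refine h2.congr_deriv ?_
      rw [hd x hx.1]; ring)
    (by simp)
    (fun x => ((Real.hasDerivAt_exp x).sub_const 1).const_mul M)
    (by
      intro x hx
      rw [Real.norm_eq_abs, abs_mul, abs_of_pos (Real.exp_pos x), mul_comm]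
      exact mul_le_mul_of_nonneg_right (hg x ⟨hx.1, hx.2.le⟩) (Real.exp_pos x).le) ht
  simp only [Real.norm_eq_abs, abs_mul, abs_of_pos (Real.exp_pos t)] at key
  have hD : |∫ u in (0:ℝ)..t, (z₁ u - z₂ u)| ≤ M * (1 - Real.exp (-t)) := by
    refine le_of_mul_le_mul_left (key.trans_eq ?_) (Real.exp_pos t)
    have : Real.exp t * Real.exp (-t) = 1 := by rw [← Real.exp_add]; simp
    linear_combination M * this
  have hexp : Real.exp (-T) ≤ Real.exp (-t) := Real.exp_le_exp.2 (by linarith [ht.2])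
  rw [hd t ht.1]
  have h3 := abs_sub (f₁ t - f₂ t) (∫ u in (0:ℝ)..t, (z₁ u - z₂ u))
  have h4 := hg t ht
  nlinarith [mul_le_mul_of_nonneg_left hexp hM0]
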